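/- (Equivalence of the primal SDP and its chordally decomposed form.) Let G = (V,E) be a chordal undirected simple graph on V = {1,…,n} with maximal cliques C_1,…,C_p, let α = (α_1,…,α_n) be a partition with N = Σ_{i=1}^n α_i, and let A_0, A_1, …, A_m ∈ S^N be symmetric matrices whose α-blocks vanish outside the pattern, i.e., (A_l)_{ij} = 0 whenever i ≠ j and (i,j) ∉ E, for every l = 0,1,…,m; let b ∈ ℝ^m. Then the optimal value of the primal SDP: minimize ⟨A_0, X⟩ subject to ⟨A_i, X⟩ = b_i for i = 1,…,m and X positive semidefinite, equals the optimal value of the decomposed problem: minimize ⟨A_0, X⟩ over symmetric X ∈ S^N and X_k ∈ S^{|C_k|} subject to ⟨A_i, X⟩ = b_i for i = 1,…,m, X_k = E_{C_k} X E_{C_k}^T for k = 1,…,p, and each X_k positive semidefinite. -/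

import Mathlib

open Matrix

/-- A maximal clique of a simple graph: a clique not contained in any other clique. -/
def IsMaxClique {V : Type*} (G : SimpleGraph V) (s : Finset V) : Prop :=
  G.IsClique ↑s ∧ ∀ t : Finset V, G.IsClique ↑t → s ⊆ t → s = t

/-- A graph is chordal if every cycle of length greater than three (i.e. of length `k + 4`)
has a chord: an edge between two nonconsecutive vertices of the cycle. -/
def IsChordal {V : Type*} (G : SimpleGraph V) : Prop :=
  ∀ (k : ℕ) (v : Fin (k + 4) → V), Function.Injective v →
    (∀ i, G.Adj (v i) (v (i + 1))) →
    ∃ i j, j ≠ i + 1 ∧ i ≠ j + 1 ∧ G.Adj (v i) (v j)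

/-- The index matrix `E_C ∈ ℝ^{|C| × N}` of a clique `C` for the block partition `α`:
its `(i, j)` block is the identity `I_{α_i}` if `i ∈ C` equals `j`, and `0` otherwise. -/
def indexMatrix {n : ℕ} (α : Fin n → ℕ) (C : Finset (Fin n)) :
    Matrix ((i : {x : Fin n // x ∈ C}) × Fin (α i.1)) ((i : Fin n) × Fin (α i)) ℝ :=
  fun p q => if (p.1 : Fin n) = q.1 ∧ (p.2 : ℕ) = (q.2 : ℕ) then 1 else 0

namespace SimpleGraph

variable {V : Type*}

/-- The graph on all of `V` keeping only those edges of `G` with both ends in `W`. -/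
def within (G : SimpleGraph V) (W : Set V) : SimpleGraph V where
  Adj x y := G.Adj x y ∧ x ∈ W ∧ y ∈ W
  symm := ⟨fun _ _ h => ⟨h.1.symm, h.2.2, h.2.1⟩⟩
  loopless := ⟨fun _ h => h.1.ne rfl⟩

lemma within_mono (G : SimpleGraph V) {W W' : Set V} (h : W ⊆ W') : G.within W ≤ G.within W' :=
  fun _ _ hxy => ⟨hxy.1, h hxy.2.1, h hxy.2.2⟩

lemma Reachable.of_closed {G : SimpleGraph V} {P : V → Prop} {a z : V} (h : G.Reachable a z)
    (ha : P a) (hP : ∀ x y, G.Adj x y → P x → P y) : P z := by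
  obtain ⟨w⟩ := h
  induction w with
  | nil => exact ha
  | cons hadj _ ih => exact ih (hP _ _ hadj ha)

lemma Reachable.mem_of_within {G : SimpleGraph V} {W : Set V} {a z : V}
    (h : (G.within W).Reachable a z) (ha : a ∈ W) : z ∈ W :=
  h.of_closed (P := (· ∈ W)) ha fun _ _ hxy _ => hxy.2.2

/-- A component of a restricted graph is connected through its own vertices. -/
lemma Reachable.within_component {G : SimpleGraph V} {W : Set V} {a z : V}
    (h : (G.within W).Reachable a z) :
    (G.within {x | (G.within W).Reachable a x}).Reachable a z := by
  refine (h.of_closed (P := fun z => (G.within W).Reachable a z ∧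
    (G.within {x | (G.within W).Reachable a x}).Reachable a z) ⟨.refl _, .refl _⟩ ?_).2
  rintro x y hxy ⟨hx, hx'⟩
  have hy := hx.trans hxy.reachable
  have hadj : (G.within {x | (G.within W).Reachable a x}).Adj x y := ⟨hxy.1, hx, hy⟩
  exact ⟨hy, hx'.trans hadj.reachable⟩

lemma Reachable.exists_geodesic {H : SimpleGraph V} {s t : V} (h : H.Reachable s t) :
    ∃ (l : ℕ) (p : ℕ → V), p 0 = s ∧ p l = t ∧ (∀ i < l, H.Adj (p i) (p (i + 1))) ∧
      ∀ i ≤ l, H.dist s (p i) = i := by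
  obtain ⟨w, hw⟩ := h.exists_walk_length_eq_dist
  refine ⟨w.length, w.getVert, by simp, by simp, fun i hi => w.adj_getVert_succ hi,
    fun i hi => ?_⟩
  have h1 := dist_le (w.take i)
  have h2 := dist_le (w.drop i)
  have h3 := Reachable.dist_triangle_left (w.take i).reachable t
  simp only [Walk.take_length, Walk.drop_length] at h1 h2
  omega

/-- A chordless path between nonadjacent vertices with all inner vertices in `A`. -/
lemma exists_chordless_path {G : SimpleGraph V} {A : Set V} {s t : V} (hst : s ≠ t)
    (hna : ¬ G.Adj s t) (h : (G.within (insert s (insert t A))).Reachable s t) :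
    ∃ (l : ℕ) (p : ℕ → V), 2 ≤ l ∧ p 0 = s ∧ p l = t ∧ (∀ i < l, G.Adj (p i) (p (i + 1))) ∧
      (∀ i, 0 < i → i < l → p i ∈ A) ∧ (∀ i j, i < j → j ≤ l → p i ≠ p j) ∧
      ∀ i j, i < j → j ≤ l → G.Adj (p i) (p j) → j = i + 1 := by
  obtain ⟨l, p, h0, hl, hadj, hd⟩ := h.exists_geodesic
  have hmem : ∀ i ≤ l, p i ∈ insert s (insert t A) := by
    intro i hi
    rcases hi.lt_or_eq with hi | rfl
    · exact (hadj i hi).2.1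
    · rw [hl]; simp
  have hinj : ∀ i j, i < j → j ≤ l → p i ≠ p j := by
    intro i j hij hj he
    have h1 := hd i (by omega)
    have h2 := hd j hj
    rw [he] at h1
    omega
  refine ⟨l, p, ?_, h0, hl, fun i hi => (hadj i hi).1, ?_, hinj, ?_⟩
  · by_contra! hlt
    interval_cases l
    · exact hst (h0.symm.trans hl)
    · have := (hadj 0 one_pos).1
      rw [zero_add, h0, hl] at this
      exact hna this
  · intro i hi hil
    rcases hmem i hil.le with h | h | h
    · exact absurd (h0.trans h.symm) (hinj 0 i hi hil.le)
    · exact absurd (h.trans hl.symm) (hinj i l hil le_rfl)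
    · exact h
  · intro i j hij hj hA
    have hA' : (G.within (insert s (insert t A))).Adj (p i) (p j) :=
      ⟨hA, hmem i (by omega), hmem j hj⟩
    have h1 := hd i (by omega)
    have h2 := hd j hj
    have h3 := Reachable.dist_triangle_right hA'.reachable s
    rw [dist_eq_one_iff_adj.2 hA'] at h3
    omega

end SimpleGraph

section Chordal

variable {V : Type*} {G : SimpleGraph V}

/-- In a chordal graph, two vertices joined through two separate connected regions
are adjacent. -/
lemma IsChordal.adj_of_reachable (hG : IsChordal G) {A B : Set V} {s t : V} (hst : s ≠ t)
    (hAB : Disjoint A B) (hno : ∀ x ∈ A, ∀ y ∈ B, ¬ G.Adj x y)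
    (hsB : s ∉ B) (htB : t ∉ B)
    (hA : (G.within (insert s (insert t A))).Reachable s t)
    (hB : (G.within (insert s (insert t B))).Reachable s t) : G.Adj s t := by
  by_contra hna
  obtain ⟨l, p, hl, p0, pl, padj, pA, pinj, pch⟩ := SimpleGraph.exists_chordless_path hst hna hA
  obtain ⟨l', q, hl', q0, ql, qadj, qB, qinj, qch⟩ :=
    SimpleGraph.exists_chordless_path hst hna hB
  obtain ⟨k, hk⟩ : ∃ k, l + l' = k + 4 := ⟨l + l' - 4, by omega⟩
  set c : ℕ → V := fun i => if i ≤ l then p i else q (l + l' - i) with hc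
  have c1 : ∀ i, i ≤ l → c i = p i := fun i hi => by simp [hc, hi]
  have c2 : ∀ i, l < i → c i = q (l + l' - i) := fun i hi => by simp [hc, hi]
  have c2' : ∀ i, l ≤ i → c i = q (l + l' - i) := by
    intro i hi
    rcases hi.lt_or_eq with hi | rfl
    · exact c2 i hi
    · rw [c1 _ le_rfl, pl, Nat.add_sub_cancel_left, ql]
  have cB : ∀ j, l < j → j < k + 4 → c j ∈ B := by
    intro j hj hj'
    rw [c2 j hj]
    exact qB _ (by omega) (by omega)
  have cadj : ∀ i, i < k + 4 → G.Adj (c i) (c (i + 1)) := by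
    intro i hi
    by_cases hil : i < l
    · rw [c1 i hil.le, c1 (i + 1) hil]
      exact padj i hil
    · rw [c2' i (by omega), c2 (i + 1) (by omega)]
      have := qadj (l + l' - (i + 1)) (by omega)
      rw [show l + l' - (i + 1) + 1 = l + l' - i by omega] at this
      exact this.symm
  have clast : c (k + 4) = c 0 := by
    rw [c2 _ (by omega), c1 0 (by omega), p0, ← hk, Nat.sub_self, q0]
  have cinj : ∀ i j, i < j → j < k + 4 → c i ≠ c j := by
    intro i j hij hj
    by_cases hjl : j ≤ l
    · rw [c1 i (by omega), c1 j hjl]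
      exact pinj i j hij hjl
    · by_cases hil : i ≤ l
      · have hjB := cB j (by omega) hj
        intro he
        rw [← he, c1 i hil] at hjB
        rcases Nat.eq_zero_or_pos i with rfl | hi
        · exact hsB (p0 ▸ hjB)
        · rcases hil.lt_or_eq with hil | rfl
          · exact Set.disjoint_left.1 hAB (pA i hi hil) hjB
          · exact htB (pl ▸ hjB)
      · rw [c2 i (by omega), c2 j (by omega)]
        exact (qinj _ _ (by omega) (by omega)).symm
  have cch : ∀ i j, i < j → j < k + 4 → G.Adj (c i) (c j) →
      j = i + 1 ∨ (i = 0 ∧ j + 1 = k + 4) := by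
    intro i j hij hj hadj
    by_cases hjl : j ≤ l
    · rw [c1 i (by omega), c1 j hjl] at hadj
      exact .inl (pch i j hij hjl hadj)
    · by_cases hil : l ≤ i
      · rw [c2' i hil, c2 j (by omega)] at hadj
        have := qch _ _ (by omega) (by omega) hadj.symm
        omega
      · rcases Nat.eq_zero_or_pos i with rfl | hi
        · rw [c1 0 (by omega), p0, ← q0, c2 j (by omega)] at hadj
          have := qch _ _ (by omega) (by omega) hadj
          omega
        · rw [c1 i (by omega)] at hadj
          exact absurd hadj (hno _ (pA i hi (by omega)) _ (cB j (by omega) hj))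
  have hsucc : ∀ i : Fin (k + 4), ((i + 1 : Fin (k + 4)) : ℕ) =
      if (i : ℕ) + 1 = k + 4 then 0 else (i : ℕ) + 1 := by
    intro i
    rw [Fin.val_add_one]
    simp only [Fin.ext_iff, Fin.val_last]
    split_ifs <;> omega
  obtain ⟨i, j, h1, h2, h3⟩ := hG k (fun i => c i)
    (by
      intro i j he
      rcases lt_trichotomy (i : ℕ) j with h | h | h
      · exact absurd he (cinj i j h j.2)
      · exact Fin.ext h
      · exact absurd he.symm (cinj j i h i.2))
    (by
      intro i
      have := cadj i i.2
      simp only [hsucc]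
      split_ifs with h
      · rwa [h, clast] at this
      · exact this)
  simp only [ne_eq, Fin.ext_iff, hsucc] at h1 h2
  rcases lt_trichotomy (i : ℕ) j with h | h | h
  · rcases cch i j h j.2 h3 with h' | ⟨h', h''⟩
    · rw [if_neg (by omega)] at h1
      exact h1 h'
    · rw [if_pos h''] at h2
      exact h2 h'
  · simp only [h] at h3
    exact h3.ne rfl
  · rcases cch j i h i.2 h3.symm with h' | ⟨h', h''⟩
    · rw [if_neg (by omega)] at h2
      exact h2 h'
    · rw [if_pos h''] at h1
      exact h1 h'

/-- Each vertex of a minimal separator has a neighbour in the component of `a`. -/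
lemma exists_adj_component [DecidableEq V] {U S : Finset V} {a b s : V}
    (haU : a ∈ U) (haS : a ∉ S)
    (hsep : ¬ (G.within ↑(U \ S)).Reachable a b)
    (hmin : (G.within ↑(U \ S.erase s)).Reachable a b) :
    ∃ x, (G.within ↑(U \ S)).Reachable a x ∧ G.Adj s x := by
  by_contra! hno
  refine hsep (hmin.of_closed (P := fun x => (G.within ↑(U \ S)).Reachable a x) (.refl _) ?_)
  rintro x y ⟨hxy, -, hy⟩ hx
  have hxU := hx.mem_of_within (by simp [haU, haS])
  have hys : y ≠ s := by
    rintro rfl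
    exact hno x hx hxy.symm
  have hadj : (G.within ↑(U \ S)).Adj x y := by
    refine ⟨hxy, hxU, ?_⟩
    simp only [Finset.coe_sdiff, Finset.coe_erase, Set.mem_sdiff, Set.mem_singleton_iff] at hy ⊢
    tauto
  exact hx.trans hadj.reachable

lemma reachable_through_component {W : Set V} {a s t x y : V}
    (hx : (G.within W).Reachable a x) (hsx : G.Adj s x)
    (hy : (G.within W).Reachable a y) (hty : G.Adj t y) :
    (G.within (insert s (insert t {z | (G.within W).Reachable a z}))).Reachable s t := by
  set K := {z | (G.within W).Reachable a z}
  have hmono : G.within K ≤ G.within (insert s (insert t K)) :=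
    G.within_mono fun z hz => .inr (.inr hz)
  have h1 : (G.within (insert s (insert t K))).Adj s x := ⟨hsx, .inl rfl, .inr (.inr hx)⟩
  have h2 : (G.within (insert s (insert t K))).Adj t y := ⟨hty, .inr (.inl rfl), .inr (.inr hy)⟩
  exact h1.reachable.trans ((hx.within_component.mono hmono).symm.trans
    ((hy.within_component.mono hmono).trans h2.symm.reachable))

/-- A vertex set of a chordal graph which is not a clique splits along a clique separator. -/
lemma IsChordal.exists_clique_separation [Finite V] [DecidableEq V] (hG : IsChordal G)
    (U : Finset V) (hU : ¬ G.IsClique ↑U) :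
    ∃ A B : Finset V, A ⊂ U ∧ B ⊂ U ∧ A ∪ B = U ∧ G.IsClique ↑(A ∩ B) ∧
      ∀ x ∈ A, x ∉ B → ∀ y ∈ B, y ∉ A → ¬ G.Adj x y := by
  classical
  obtain ⟨a, ha, b, hb, hab, hnadj⟩ :
      ∃ a ∈ U, ∃ b ∈ U, a ≠ b ∧ ¬ G.Adj a b := by
    simpa [SimpleGraph.isClique_iff, Set.Pairwise] using hU
  let P : Finset V → Prop := fun S =>
    a ∉ S ∧ b ∉ S ∧ S ⊆ U ∧ ¬ (G.within ↑(U \ S)).Reachable a b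
  have hP0 : P (U \ {a, b}) := by
    refine ⟨by simp, by simp, Finset.sdiff_subset, fun h => ?_⟩
    refine hab (h.of_closed (P := fun z => a = z) rfl ?_)
    rintro x y ⟨hxy, -, hy⟩ rfl
    have : y = a ∨ y = b := by
      simp only [Finset.coe_sdiff, Set.mem_sdiff, Finset.mem_coe] at hy
      by_contra hne
      exact hy.2 ⟨hy.1, by simpa using hne⟩
    rcases this with rfl | rfl
    · rfl
    · exact absurd hxy hnadj
  obtain ⟨S, -, ⟨haS, hbS, hSU, hsep⟩, hmin⟩ := Finite.exists_le_minimal (p := P) hP0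
  have hconn : ∀ s ∈ S, (G.within ↑(U \ S.erase s)).Reachable a b := by
    intro s hs
    by_contra hcon
    have := hmin (y := S.erase s) ⟨fun h => haS (Finset.mem_of_mem_erase h),
      fun h => hbS (Finset.mem_of_mem_erase h), (Finset.erase_subset _ _).trans hSU, hcon⟩
      (Finset.erase_subset _ _)
    exact Finset.notMem_erase s S (this hs)
  set K := {z | (G.within ↑(U \ S)).Reachable a z} with hK
  set L := {z | (G.within ↑(U \ S)).Reachable b z} with hL
  have hKU : ∀ x ∈ K, x ∈ U ∧ x ∉ S := fun x hx => by
    simpa using SimpleGraph.Reachable.mem_of_within hx (by simp [ha, haS])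
  have hLU : ∀ x ∈ L, x ∈ U ∧ x ∉ S := fun x hx => by
    simpa using SimpleGraph.Reachable.mem_of_within hx (by simp [hb, hbS])
  have hKcl : ∀ x ∈ K, ∀ y ∈ U, y ∉ S → G.Adj x y → y ∈ K := by
    intro x hx y hyU hyS hxy
    have hadj : (G.within ↑(U \ S)).Adj x y :=
      ⟨hxy, by simpa using hKU x hx, by simp [hyU, hyS]⟩
    exact SimpleGraph.Reachable.trans hx hadj.reachable
  have hKL : Disjoint K L := Set.disjoint_left.2 fun x hx hx' =>
    hsep (SimpleGraph.Reachable.trans hx (SimpleGraph.Reachable.symm hx'))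
  have hS : G.IsClique ↑S := by
    intro s hs t ht hst
    obtain ⟨x, hx, hsx⟩ := exists_adj_component ha haS hsep (hconn s hs)
    obtain ⟨y, hy, hty⟩ := exists_adj_component ha haS hsep (hconn t ht)
    obtain ⟨x', hx', hsx'⟩ :=
      exists_adj_component hb hbS (fun h => hsep h.symm) (hconn s hs).symm
    obtain ⟨y', hy', hty'⟩ :=
      exists_adj_component hb hbS (fun h => hsep h.symm) (hconn t ht).symm
    refine hG.adj_of_reachable (A := K) (B := L) hst hKL ?_ (fun h => (hLU s h).2 hs)
      (fun h => (hLU t h).2 ht) (reachable_through_component hx hsx hy hty)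
      (reachable_through_component hx' hsx' hy' hty')
    intro x hx y hy hxy
    exact Set.disjoint_left.1 hKL (hKcl x hx y (hLU y hy).1 (hLU y hy).2 hxy) hy
  have haK : a ∈ K := SimpleGraph.Reachable.refl _
  have hbK : b ∉ K := hsep
  refine ⟨U.filter fun x => x ∈ S ∨ x ∈ K, U.filter fun x => x ∉ K, ?_, ?_, ?_, ?_, ?_⟩
  · exact Finset.filter_ssubset.2 ⟨b, hb, by tauto⟩
  · exact Finset.filter_ssubset.2 ⟨a, ha, by tauto⟩
  · ext x
    simp only [Finset.mem_union, Finset.mem_filter]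
    tauto
  · refine hS.subset fun x hx => ?_
    simp only [Finset.coe_inter, Finset.coe_filter, Set.mem_inter_iff, Set.mem_ofPred_eq] at hx
    rcases hx with ⟨⟨-, h | h⟩, -, h'⟩
    · exact h
    · exact absurd h h'
  · intro x hx hxB y hy hyA hxy
    simp only [Finset.mem_filter] at hx hxB hy hyA
    have hxK : x ∈ K := by tauto
    exact hy.2 (hKcl x hxK y hy.1 (by tauto) hxy)

end Chordal

section Gram

variable {E : Type*} [NormedAddCommGroup E] [InnerProductSpace ℝ E]

/-- Two finite families with the same Gram matrix differ by a linear isometry. -/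
lemma exists_linearIsometry_of_inner_eq [FiniteDimensional ℝ E] {P : Type*} [Fintype P]
    (g h : P → E) (hgh : ∀ p q, inner ℝ (g p) (g q) = inner ℝ (h p) (h q)) :
    ∃ L : E →ₗᵢ[ℝ] E, ∀ p, L (g p) = h p := by
  classical
  let Γ : (P → ℝ) →ₗ[ℝ] E := Fintype.linearCombination ℝ g
  let Δ : (P → ℝ) →ₗ[ℝ] E := Fintype.linearCombination ℝ h
  have hnorm : ∀ c, ‖Δ c‖ = ‖Γ c‖ := by
    intro c
    rw [← sq_eq_sq₀ (norm_nonneg _) (norm_nonneg _), ← real_inner_self_eq_norm_sq,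
      ← real_inner_self_eq_norm_sq]
    simp only [Γ, Δ, Fintype.linearCombination_apply, sum_inner, inner_sum, real_inner_smul_left,
      real_inner_smul_right, hgh]
  obtain ⟨σ, hσ⟩ := Γ.rangeRestrict.exists_rightInverse_of_surjective Γ.range_rangeRestrict
  have hσ' : ∀ y, Γ (σ y) = y := fun y => congrArg Subtype.val (LinearMap.congr_fun hσ y)
  let L : LinearMap.range Γ →ₗᵢ[ℝ] E :=
    ⟨Δ ∘ₗ σ, fun y => by rw [LinearMap.comp_apply, hnorm, hσ', Submodule.coe_norm]⟩
  have hg : ∀ p, Γ (Pi.single p 1) = g p := fun p => by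
    simp [Γ, Fintype.linearCombination_apply_single]
  have hh : ∀ p, Δ (Pi.single p 1) = h p := fun p => by
    simp [Δ, Fintype.linearCombination_apply_single]
  refine ⟨L.extend, fun p => ?_⟩
  let y : LinearMap.range Γ := ⟨g p, Pi.single p 1, hg p⟩
  change L.extend (y : E) = h p
  rw [LinearIsometry.extend_apply]
  change Δ (σ y) = h p
  rw [← sub_eq_zero, ← hh p, ← map_sub, ← norm_eq_zero, hnorm, map_sub, hσ', hg, sub_self,
    norm_zero]

open scoped MatrixOrder in
lemma Matrix.PosSemidef.exists_inner_eq {I : Type*} [Fintype I] [DecidableEq I]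
    {M : Matrix I I ℝ} (hM : M.PosSemidef) :
    ∃ f : I → EuclideanSpace ℝ I, ∀ p q, inner ℝ (f p) (f q) = M p q := by
  obtain ⟨B, rfl⟩ := CStarAlgebra.nonneg_iff_eq_star_mul_self.1 hM.nonneg
  rw [Matrix.star_eq_conjTranspose]
  refine ⟨fun p => WithLp.toLp 2 fun r => B r p, fun p q => ?_⟩
  simp [PiLp.inner_apply, Matrix.mul_apply, mul_comm]

/-- Partial Gram realizations along a chordal graph glue from cliques to the whole graph. -/
lemma IsChordal.exists_inner_eq [FiniteDimensional ℝ E] {V : Type*} [Finite V] {G : SimpleGraph V}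
    (hG : IsChordal G) {I : Type*} [Fintype I] (π : I → V) (X : I → I → ℝ)
    (hX : ∀ K : Finset V, G.IsClique ↑K →
      ∃ f : I → E, ∀ p q, π p ∈ K → π q ∈ K → inner ℝ (f p) (f q) = X p q)
    (U : Finset V) :
    ∃ f : I → E, ∀ p q, π p ∈ U → π q ∈ U → (π p = π q ∨ G.Adj (π p) (π q)) →
      inner ℝ (f p) (f q) = X p q := by
  classical
  induction U using Finset.strongInduction with
  | H U ih =>
    by_cases hU : G.IsClique ↑U
    · obtain ⟨f, hf⟩ := hX U hU
      exact ⟨f, fun p q hp hq _ => hf p q hp hq⟩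
    obtain ⟨A, B, hA, hB, rfl, hS, hno⟩ := hG.exists_clique_separation U hU
    obtain ⟨f, hf⟩ := ih A hA
    obtain ⟨g, hg⟩ := ih B hB
    obtain ⟨L, hL⟩ := exists_linearIsometry_of_inner_eq
      (P := {p : I // π p ∈ A ∩ B}) (fun p => g p) (fun p => f p) (by
        rintro ⟨p, hp⟩ ⟨q, hq⟩
        have hpq : π p = π q ∨ G.Adj (π p) (π q) := or_iff_not_imp_left.2 fun h => hS hp hq h
        rw [Finset.mem_inter] at hp hq
        exact (hg p q hp.2 hq.2 hpq).trans (hf p q hp.1 hq.1 hpq).symm)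
    let F : I → E := fun p => if π p ∈ A then f p else L (g p)
    have hFA : ∀ p, π p ∈ A → F p = f p := fun p hp => if_pos hp
    have hFB : ∀ p, π p ∈ B → F p = L (g p) := fun p hp => by
      by_cases h : π p ∈ A
      · rw [hFA p h]
        exact (hL ⟨p, Finset.mem_inter.2 ⟨h, hp⟩⟩).symm
      · exact if_neg h
    refine ⟨F, fun p q hp hq hpq => ?_⟩
    by_cases hpqA : π p ∈ A ∧ π q ∈ A
    · rw [hFA p hpqA.1, hFA q hpqA.2, hf p q hpqA.1 hpqA.2 hpq]
    by_cases hpqB : π p ∈ B ∧ π q ∈ B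
    · rw [hFB p hpqB.1, hFB q hpqB.2, L.inner_map_map, hg p q hpqB.1 hpqB.2 hpq]
    rw [Finset.mem_union] at hp hq
    exfalso
    rcases hpq with h | h
    · rw [h] at hp hpqA hpqB
      tauto
    · by_cases hpA : π p ∈ A
      · exact hno (π p) hpA (by tauto) (π q) (by tauto) (by tauto) h
      · exact hno (π q) (by tauto) (by tauto) (π p) (by tauto) hpA h.symm

end Gram

section Blocks

variable {n : ℕ} {α : Fin n → ℕ}

lemma indexMatrix_eq_submatrix (α : Fin n → ℕ) (K : Finset (Fin n)) :
    indexMatrix α K = (1 : Matrix ((i : Fin n) × Fin (α i)) ((i : Fin n) × Fin (α i)) ℝ).submatrix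
      (fun p => ⟨p.1.1, p.2⟩) id := by
  ext ⟨i, a⟩ ⟨j, c⟩
  simp only [indexMatrix, Matrix.submatrix_apply, Matrix.one_apply, id]
  congr 1
  rw [Sigma.mk.injEq]
  refine propext (and_congr_right fun h => ?_)
  subst h
  rw [heq_eq_eq, Fin.ext_iff]

lemma indexMatrix_mul_mul_transpose (K : Finset (Fin n))
    (X : Matrix ((i : Fin n) × Fin (α i)) ((i : Fin n) × Fin (α i)) ℝ) :
    indexMatrix α K * X * (indexMatrix α K)ᵀ =
      X.submatrix (fun p : (i : {x : Fin n // x ∈ K}) × Fin (α i.1) => ⟨p.1.1, p.2⟩)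
        (fun p => ⟨p.1.1, p.2⟩) := by
  rw [indexMatrix_eq_submatrix, Matrix.transpose_submatrix, Matrix.transpose_one]
  ext p q
  simp [Matrix.mul_apply, Matrix.one_apply]

lemma indexMatrix_mul_transpose (K : Finset (Fin n)) :
    indexMatrix α K * (indexMatrix α K)ᵀ = 1 := by
  have h := indexMatrix_mul_mul_transpose (α := α) K 1
  rw [Matrix.mul_one] at h
  rw [h]
  refine Matrix.submatrix_one _ ?_
  rintro ⟨⟨i, hi⟩, a⟩ ⟨⟨j, hj⟩, c⟩ h
  rw [Sigma.mk.injEq] at h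
  obtain ⟨rfl, h⟩ := h
  exact congrArg (Sigma.mk _) (eq_of_heq h)

/-- A positive semidefinite clique block is the Gram matrix of some vectors. -/
lemma exists_inner_eq_of_posSemidef_block (K : Finset (Fin n))
    (X : Matrix ((i : Fin n) × Fin (α i)) ((i : Fin n) × Fin (α i)) ℝ)
    (hX : (indexMatrix α K * X * (indexMatrix α K)ᵀ).PosSemidef) :
    ∃ f : ((i : Fin n) × Fin (α i)) → EuclideanSpace ℝ ((i : Fin n) × Fin (α i)),
      ∀ p q, p.1 ∈ K → q.1 ∈ K → inner ℝ (f p) (f q) = X p q := by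
  set F := indexMatrix α K with hF
  have hY := hX.conjTranspose_mul_mul_same F
  rw [Matrix.conjTranspose_eq_transpose_of_trivial] at hY
  obtain ⟨f, hf⟩ := hY.exists_inner_eq
  refine ⟨f, ?_⟩
  rintro ⟨i, a⟩ ⟨j, c⟩ hi hj
  have hE : F * (Fᵀ * (F * X * Fᵀ) * F) * Fᵀ = F * X * Fᵀ := by
    have h1 : F * Fᵀ = 1 := indexMatrix_mul_transpose K
    calc _ = (F * Fᵀ) * (F * X * Fᵀ) * (F * Fᵀ) := by simp only [Matrix.mul_assoc]
      _ = _ := by rw [h1, Matrix.one_mul, Matrix.mul_one]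
  have h := congrFun (congrFun hE ⟨⟨i, hi⟩, a⟩) ⟨⟨j, hj⟩, c⟩
  rw [hF, indexMatrix_mul_mul_transpose, indexMatrix_mul_mul_transpose] at h
  simp only [Matrix.submatrix_apply] at h
  rw [hf, hF, indexMatrix_mul_mul_transpose]
  exact h

/-- The trace pairing with a matrix supported on the pattern of `G` only sees the pattern. -/
lemma trace_mul_eq_of_pattern {G : SimpleGraph (Fin n)}
    {A X Y : Matrix ((i : Fin n) × Fin (α i)) ((i : Fin n) × Fin (α i)) ℝ}
    (hA : ∀ i j : Fin n, i ≠ j → ¬ G.Adj i j →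
      ∀ (a : Fin (α i)) (c : Fin (α j)), A ⟨i, a⟩ ⟨j, c⟩ = 0)
    (hXY : ∀ p q : (i : Fin n) × Fin (α i), p.1 = q.1 ∨ G.Adj p.1 q.1 → X p q = Y p q) :
    (A * X).trace = (A * Y).trace := by
  simp only [Matrix.trace, Matrix.diag_apply, Matrix.mul_apply]
  refine Finset.sum_congr rfl fun p _ => Finset.sum_congr rfl fun q _ => ?_
  by_cases h : p.1 = q.1 ∨ G.Adj p.1 q.1
  · rw [hXY q p (h.imp Eq.symm fun h => h.symm)]
  · rw [not_or] at h
    have h0 : A p q = 0 := hA p.1 q.1 h.1 h.2 p.2 q.2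
    rw [h0, zero_mul, zero_mul]

/-- **Chordal positive semidefinite completion**, for block matrices. -/
lemma IsChordal.exists_posSemidef_completion {G : SimpleGraph (Fin n)} (hG : IsChordal G)
    (X : Matrix ((i : Fin n) × Fin (α i)) ((i : Fin n) × Fin (α i)) ℝ)
    (hX : ∀ K, IsMaxClique G K → (indexMatrix α K * X * (indexMatrix α K)ᵀ).PosSemidef) :
    ∃ Y : Matrix ((i : Fin n) × Fin (α i)) ((i : Fin n) × Fin (α i)) ℝ, Y.PosSemidef ∧
      ∀ p q : (i : Fin n) × Fin (α i), p.1 = q.1 ∨ G.Adj p.1 q.1 → Y p q = X p q := by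
  obtain ⟨f, hf⟩ := hG.exists_inner_eq (E := EuclideanSpace ℝ ((i : Fin n) × Fin (α i)))
    (fun p : (i : Fin n) × Fin (α i) => p.1) X (fun K hK => by
      obtain ⟨M, hKM, hM, hmax⟩ :=
        Finite.exists_le_maximal (p := fun s : Finset (Fin n) => G.IsClique ↑s) hK
      obtain ⟨f, hf⟩ := exists_inner_eq_of_posSemidef_block M X
        (hX M ⟨hM, fun t ht h => le_antisymm h (hmax ht h)⟩)
      exact ⟨f, fun p q hp hq => hf p q (hKM hp) (hKM hq)⟩) Finset.univ
  exact ⟨Matrix.gram ℝ f, Matrix.posSemidef_gram ℝ f, fun p q hpq =>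
    hf p q (Finset.mem_univ _) (Finset.mem_univ _) hpq⟩

end Blocks

/-- **Equivalence of the primal SDP and its chordally decomposed form.** Let `G` be a
chordal graph on `{1,…,n}` with maximal cliques `C_1, …, C_p`, and let `A_0, A_1, …, A_m`
be symmetric matrices whose `α`-blocks vanish outside the pattern of `G`. Then the optimal
value (infimum, in the extended reals) of the primal SDP
`min ⟨A_0, X⟩ s.t. ⟨A_i, X⟩ = b_i, X ⪰ 0` equals the optimal value of the decomposed
problem `min ⟨A_0, X⟩ s.t. ⟨A_i, X⟩ = b_i, X_k = E_{C_k} X E_{C_k}ᵀ, X_k ⪰ 0`. -/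
theorem primal_sdp_chordal_decomposition
    {n p m : ℕ} (G : SimpleGraph (Fin n))
    (hchordal : IsChordal G)
    (C : Fin p → Finset (Fin n))
    (hC : ∀ s : Finset (Fin n), IsMaxClique G s ↔ ∃ k, s = C k)
    (α : Fin n → ℕ)
    (A0 : Matrix ((i : Fin n) × Fin (α i)) ((i : Fin n) × Fin (α i)) ℝ)
    (A : Fin m → Matrix ((i : Fin n) × Fin (α i)) ((i : Fin n) × Fin (α i)) ℝ)
    (b : Fin m → ℝ)
    (hA0sym : A0.IsHermitian) (hAsym : ∀ l, (A l).IsHermitian)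
    (hA0sparse : ∀ i j : Fin n, i ≠ j → ¬ G.Adj i j →
      ∀ (a : Fin (α i)) (c : Fin (α j)), A0 ⟨i, a⟩ ⟨j, c⟩ = 0)
    (hAsparse : ∀ l, ∀ i j : Fin n, i ≠ j → ¬ G.Adj i j →
      ∀ (a : Fin (α i)) (c : Fin (α j)), A l ⟨i, a⟩ ⟨j, c⟩ = 0) :
    sInf {v : EReal |
        ∃ X : Matrix ((i : Fin n) × Fin (α i)) ((i : Fin n) × Fin (α i)) ℝ,
          X.PosSemidef ∧ (∀ i, (A i * X).trace = b i) ∧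
          v = ((A0 * X).trace : ℝ)} =
    sInf {v : EReal |
        ∃ X : Matrix ((i : Fin n) × Fin (α i)) ((i : Fin n) × Fin (α i)) ℝ,
        ∃ Xk : (k : Fin p) →
            Matrix ((i : {x : Fin n // x ∈ C k}) × Fin (α i.1))
                   ((i : {x : Fin n // x ∈ C k}) × Fin (α i.1)) ℝ,
          X.IsHermitian ∧ (∀ i, (A i * X).trace = b i) ∧
          (∀ k, Xk k = indexMatrix α (C k) * X * (indexMatrix α (C k))ᵀ) ∧
          (∀ k, (Xk k).PosSemidef) ∧
          v = ((A0 * X).trace : ℝ)} := by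
  congr 1
  ext v
  constructor
  · rintro ⟨X, hX, hb, rfl⟩
    refine ⟨X, fun k => indexMatrix α (C k) * X * (indexMatrix α (C k))ᵀ, hX.1, hb,
      fun _ => rfl, fun k => ?_, rfl⟩
    have h := hX.mul_mul_conjTranspose_same (indexMatrix α (C k))
    rwa [Matrix.conjTranspose_eq_transpose_of_trivial] at h
  · rintro ⟨X, Xk, -, hb, hXk, hpsd, rfl⟩
    obtain ⟨Y, hY, hYX⟩ := hchordal.exists_posSemidef_completion X fun K hK => by
      obtain ⟨k, rfl⟩ := (hC K).1 hK
      exact hXk k ▸ hpsd k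
    exact ⟨Y, hY, fun i => (trace_mul_eq_of_pattern (hAsparse i) hYX).trans (hb i),
      by rw [trace_mul_eq_of_pattern hA0sparse hYX]⟩
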